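/- Let B, J, l_p, l_i, m, δ, ε > 0. Define A₀ = [[−B/J, −1/J],[l_i, 0]], A₁ = [[0, 0],[−B/J, −1/J]], and μ(x) = l_p·x/((x/m)² + 1). Let P be a 2×2 real symmetric positive definite matrix such that Q₀ := −(A₀ᵀP + PA₀) is positive definite, set Q₁ := A₁ᵀP + PA₁, and suppose γ* := λ_min(Q₀)/λ_max(P) − l_p·‖Q₁‖/λ_min(P) − 2‖P‖δ/(ε·λ_min(P)) > 0. Let T₀ ∈ ℝ and let d : [T₀, ∞) → ℝ² be differentiable with |d₁(t)| ≤ m for all t, and suppose d'(t) = A₀ d(t) + μ'(d₁(t))·(A₁ d(t)) + w(t)·(0,1) where |w(t)| ≤ δ for all t. Then for every t ≥ T₀ at which ‖d(t)‖ ≥ ε, the function V(t) = d(t)ᵀ P d(t) satisfies V'(t) ≤ −γ* · V(t); in particular, there exists a finite time T_f ≥ T₀ with ‖d(T_f)‖ ≤ ε. -/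

import Mathlib

open Matrix

/-- The minimal eigenvalue of a Hermitian real matrix. -/
noncomputable def lamMin {n : Type*} [Fintype n] [DecidableEq n] {M : Matrix n n ℝ}
    (hM : M.IsHermitian) : ℝ := ⨅ i, hM.eigenvalues i

/-- The maximal eigenvalue of a Hermitian real matrix. -/
noncomputable def lamMax {n : Type*} [Fintype n] [DecidableEq n] {M : Matrix n n ℝ}
    (hM : M.IsHermitian) : ℝ := ⨆ i, hM.eigenvalues i

/-- The (Euclidean ℓ²) operator norm of a real square matrix. -/
noncomputable def opNorm {n : Type*} [Fintype n] [DecidableEq n] (M : Matrix n n ℝ) : ℝ :=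
  ‖Matrix.toEuclideanCLM (𝕜 := ℝ) M‖

/-- The Euclidean norm of a vector in `ℝⁿ`. -/
noncomputable def euclNorm {n : Type*} [Fintype n] (x : n → ℝ) : ℝ :=
  Real.sqrt (x ⬝ᵥ x)

lemma rayleigh_expand {n : Type*} [Fintype n] [DecidableEq n] {M : Matrix n n ℝ}
    (hM : M.IsHermitian) (x : n → ℝ) :
    ∃ c : n → ℝ, x ⬝ᵥ x = ∑ i, c i ^ 2 ∧ x ⬝ᵥ M *ᵥ x = ∑ i, hM.eigenvalues i * c i ^ 2 := by
  have key : ∀ y : n → ℝ, x ⬝ᵥ y = ∑ i, ((hM.eigenvectorBasis i : n → ℝ) ⬝ᵥ x) *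
      ((hM.eigenvectorBasis i : n → ℝ) ⬝ᵥ y) := by
    intro y
    have h := hM.eigenvectorBasis.sum_inner_mul_inner (WithLp.toLp 2 x) (WithLp.toLp 2 y)
    simp only [EuclideanSpace.inner_eq_star_dotProduct, star_trivial] at h
    rw [dotProduct_comm, ← h]
    refine Finset.sum_congr rfl fun i _ => ?_
    rw [dotProduct_comm y]
  refine ⟨fun i => (hM.eigenvectorBasis i : n → ℝ) ⬝ᵥ x, ?_, ?_⟩
  · rw [key x]; exact Finset.sum_congr rfl fun i _ => by ring
  · rw [key]
    refine Finset.sum_congr rfl fun i _ => ?_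
    have h2 : (hM.eigenvectorBasis i : n → ℝ) ⬝ᵥ M *ᵥ x
        = hM.eigenvalues i * ((hM.eigenvectorBasis i : n → ℝ) ⬝ᵥ x) := by
      have ht : Mᵀ = M := by
        ext i j; simpa using hM.apply i j
      rw [dotProduct_mulVec, ← mulVec_transpose, ht, hM.mulVec_eigenvectorBasis, smul_dotProduct,
        smul_eq_mul]
    rw [h2]; ring

lemma lamMin_mul_le {n : Type*} [Fintype n] [DecidableEq n] {M : Matrix n n ℝ}
    (hM : M.IsHermitian) (x : n → ℝ) : lamMin hM * (x ⬝ᵥ x) ≤ x ⬝ᵥ M *ᵥ x := by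
  obtain ⟨c, h1, h2⟩ := rayleigh_expand hM x
  rw [h1, h2, Finset.mul_sum]
  exact Finset.sum_le_sum fun i _ =>
    mul_le_mul_of_nonneg_right (ciInf_le (Set.finite_range _).bddBelow i) (sq_nonneg _)

lemma le_lamMax_mul {n : Type*} [Fintype n] [DecidableEq n] {M : Matrix n n ℝ}
    (hM : M.IsHermitian) (x : n → ℝ) : x ⬝ᵥ M *ᵥ x ≤ lamMax hM * (x ⬝ᵥ x) := by
  obtain ⟨c, h1, h2⟩ := rayleigh_expand hM x
  rw [h1, h2, Finset.mul_sum]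
  exact Finset.sum_le_sum fun i _ =>
    mul_le_mul_of_nonneg_right (le_ciSup (Set.finite_range _).bddAbove i) (sq_nonneg _)

lemma lamMin_pos {n : Type*} [Fintype n] [DecidableEq n] [Nonempty n] {M : Matrix n n ℝ}
    (hM : M.PosDef) : 0 < lamMin hM.1 := by
  obtain ⟨i, hi⟩ := exists_eq_ciInf_of_finite (f := hM.1.eigenvalues)
  rw [lamMin, ← hi]
  exact hM.eigenvalues_pos i

lemma lamMin_le_lamMax {n : Type*} [Fintype n] [DecidableEq n] [Nonempty n] {M : Matrix n n ℝ}
    (hM : M.IsHermitian) : lamMin hM ≤ lamMax hM :=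
  (ciInf_le (Set.finite_range _).bddBelow (Classical.arbitrary n)).trans
    (le_ciSup (f := hM.eigenvalues) (Set.finite_range _).bddAbove (Classical.arbitrary n))

lemma euclNorm_eq {n : Type*} [Fintype n] (x : n → ℝ) : euclNorm x = ‖WithLp.toLp 2 x‖ := by
  rw [euclNorm, EuclideanSpace.norm_eq]
  congr 1
  simp [dotProduct, sq]

lemma euclNorm_sq {n : Type*} [Fintype n] (x : n → ℝ) : euclNorm x ^ 2 = x ⬝ᵥ x := by
  rw [euclNorm, Real.sq_sqrt]
  exact Finset.sum_nonneg fun i _ => mul_self_nonneg _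

lemma abs_bilin_le {n : Type*} [Fintype n] [DecidableEq n] (M : Matrix n n ℝ) (x y : n → ℝ) :
    |x ⬝ᵥ M *ᵥ y| ≤ opNorm M * (euclNorm x * euclNorm y) := by
  have h1 := abs_real_inner_le_norm (WithLp.toLp 2 x)
    (Matrix.toEuclideanCLM (𝕜 := ℝ) M (WithLp.toLp 2 y))
  have h2 := (Matrix.toEuclideanCLM (𝕜 := ℝ) M).le_opNorm (WithLp.toLp 2 y)
  have h3 : inner ℝ (WithLp.toLp 2 x) (Matrix.toEuclideanCLM (𝕜 := ℝ) M (WithLp.toLp 2 y))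
      = x ⬝ᵥ M *ᵥ y := by
    simp [EuclideanSpace.inner_eq_star_dotProduct, dotProduct_comm]
  rw [h3] at h1
  rw [euclNorm_eq, euclNorm_eq, opNorm]
  calc _ ≤ _ := h1
    _ ≤ _ := mul_le_mul_of_nonneg_left h2 (norm_nonneg _)
    _ = _ := by ring

lemma hasDerivAt_quad (P : Matrix (Fin 2) (Fin 2) ℝ) (d : ℝ → Fin 2 → ℝ) (d' : Fin 2 → ℝ) (t : ℝ)
    (h : HasDerivAt d d' t) :
    HasDerivAt (fun s => d s ⬝ᵥ P *ᵥ (d s)) (d' ⬝ᵥ P *ᵥ (d t) + d t ⬝ᵥ P *ᵥ d') t := by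
  have h0 := hasDerivAt_pi.1 h 0
  have h1 := hasDerivAt_pi.1 h 1
  simp only [dotProduct, mulVec, Fin.sum_univ_two]
  refine HasDerivAt.congr_deriv ((h0.mul ((h0.const_mul (P 0 0)).add (h1.const_mul (P 0 1)))).add
    (h1.mul ((h0.const_mul (P 1 0)).add (h1.const_mul (P 1 1))))) ?_
  simp only [Pi.add_apply]
  ring

lemma abs_deriv_mu_le (lp m : ℝ) (hlp : 0 < lp) (hm : 0 < m) (μ : ℝ → ℝ)
    (hμ : ∀ x : ℝ, μ x = lp * x / ((x / m) ^ 2 + 1)) (x : ℝ) : |deriv μ x| ≤ lp := by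
  have hpos : 0 < (x / m) ^ 2 + 1 := by positivity
  have h : HasDerivAt μ (lp * (1 - (x / m) ^ 2) / ((x / m) ^ 2 + 1) ^ 2) x := by
    have e : μ = fun x => lp * x / ((x / m) ^ 2 + 1) := funext hμ
    rw [e]
    have hn := (hasDerivAt_id x).const_mul lp
    have hd := (((hasDerivAt_id x).div_const m).pow 2).add_const 1
    refine HasDerivAt.congr_deriv (hn.div hd hpos.ne') ?_
    simp
    field_simp
    ring
  rw [h.deriv, abs_div, abs_mul, abs_of_pos hlp, abs_of_pos (pow_pos hpos 2), mul_div_assoc]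
  refine mul_le_of_le_one_right hlp.le ?_
  rw [div_le_one (pow_pos hpos 2), abs_le]
  constructor <;> nlinarith [sq_nonneg (x / m), sq_nonneg ((x / m) ^ 2)]

lemma quad_identity (A0 A1 P : Matrix (Fin 2) (Fin 2) ℝ) (hs : P 1 0 = P 0 1) (x e : Fin 2 → ℝ)
    (f w : ℝ) :
    (A0 *ᵥ x + f • A1 *ᵥ x + w • e) ⬝ᵥ P *ᵥ x + x ⬝ᵥ P *ᵥ (A0 *ᵥ x + f • A1 *ᵥ x + w • e)
      = -(x ⬝ᵥ (-(A0ᵀ * P + P * A0)) *ᵥ x) + f * (x ⬝ᵥ (A1ᵀ * P + P * A1) *ᵥ x)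
        + 2 * (w * (x ⬝ᵥ P *ᵥ e)) := by
  simp only [dotProduct, mulVec, Fin.sum_univ_two, Matrix.mul_apply, Matrix.add_apply,
    Matrix.neg_apply, Matrix.transpose_apply, Pi.add_apply, Pi.smul_apply, smul_eq_mul, hs]
  ring

lemma scalar_bound (a L l q p lp δ ε N V n D g X Y Z f w : ℝ) (ha : 0 < a) (hL : 0 < L)
    (hl : 0 < l) (hq : 0 ≤ q) (hp : 0 ≤ p) (hlp : 0 < lp) (hδ : 0 < δ) (hε : 0 < ε)
    (hN : n ^ 2 = N) (hn : ε ≤ n) (hg : g = a / L - lp * q / l - 2 * p * δ / (ε * l))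
    (h1 : a * N ≤ X) (h2 : V ≤ L * N) (h3 : l * N ≤ V) (hY : |Y| ≤ q * N) (hZ : |Z| ≤ p * n)
    (hf : |f| ≤ lp) (hw : |w| ≤ δ) (hD : D = -X + f * Y + 2 * (w * Z)) : D ≤ -g * V := by
  have e1 : a / L * V ≤ a * N := by
    calc a / L * V ≤ a / L * (L * N) := mul_le_mul_of_nonneg_left h2 (by positivity)
      _ = a * N := by field_simp
  have e2 : lp * q * N ≤ lp * q / l * V := by
    calc lp * q * N = lp * q / l * (l * N) := by field_simp
      _ ≤ _ := mul_le_mul_of_nonneg_left h3 (by positivity)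
  have e3 : 2 * p * δ * n ≤ 2 * p * δ / (ε * l) * V := by
    calc 2 * p * δ * n = 2 * p * δ / ε * (ε * n) := by field_simp
      _ ≤ 2 * p * δ / ε * N := by
        refine mul_le_mul_of_nonneg_left ?_ (by positivity)
        nlinarith
      _ = 2 * p * δ / (ε * l) * (l * N) := by field_simp
      _ ≤ _ := mul_le_mul_of_nonneg_left h3 (by positivity)
  have e4 : f * Y ≤ lp * (q * N) := by
    calc f * Y ≤ |f * Y| := le_abs_self _
      _ = |f| * |Y| := abs_mul _ _
      _ ≤ _ := mul_le_mul hf hY (abs_nonneg _) hlp.le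
  have e5 : w * Z ≤ δ * (p * n) := by
    calc w * Z ≤ |w * Z| := le_abs_self _
      _ = |w| * |Z| := abs_mul _ _
      _ ≤ _ := mul_le_mul hw hZ (abs_nonneg _) hδ.le
  rw [hD, hg]
  linarith

/-- **Theorem 3 of the paper.** Exponential decay of the Lyapunov function
of the outer-loop load torque estimation error outside the ball of radius `ε`, and
convergence of the estimation error into that ball in finite time. -/
theorem outer_loop_dob_convergence (B J lp li m δ ε : ℝ)
    (hB : 0 < B) (hJ : 0 < J) (hlp : 0 < lp) (hli : 0 < li) (hm : 0 < m)
    (hδ : 0 < δ) (hε : 0 < ε)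
    (A0 A1 : Matrix (Fin 2) (Fin 2) ℝ)
    (hA0 : A0 = !![-B / J, -1 / J; li, 0])
    (hA1 : A1 = !![0, 0; -B / J, -1 / J])
    (μ : ℝ → ℝ) (hμ : ∀ x : ℝ, μ x = lp * x / ((x / m) ^ 2 + 1))
    (P : Matrix (Fin 2) (Fin 2) ℝ) (hP : P.PosDef)
    (hQ0 : (-(A0ᵀ * P + P * A0)).PosDef)
    (γstar : ℝ)
    (hγdef : γstar = lamMin hQ0.1 / lamMax hP.1
        - lp * opNorm (A1ᵀ * P + P * A1) / lamMin hP.1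
        - 2 * opNorm P * δ / (ε * lamMin hP.1))
    (hγpos : 0 < γstar)
    (T0 : ℝ) (d : ℝ → Fin 2 → ℝ) (w : ℝ → ℝ)
    (hd1 : ∀ t, T0 ≤ t → |d t 0| ≤ m)
    (hw : ∀ t, T0 ≤ t → |w t| ≤ δ)
    (hode : ∀ t, T0 ≤ t →
      HasDerivAt d (A0.mulVec (d t) + deriv μ (d t 0) • A1.mulVec (d t) + w t • ![0, 1]) t) :
    (∀ t, T0 ≤ t → ε ≤ euclNorm (d t) →
        deriv (fun s => d s ⬝ᵥ P.mulVec (d s)) t ≤ -γstar * (d t ⬝ᵥ P.mulVec (d t))) ∧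
      ∃ Tf : ℝ, T0 ≤ Tf ∧ euclNorm (d Tf) ≤ ε := by
  have hs : P 1 0 = P 0 1 := by simpa using hP.1.apply 0 1
  have hl := lamMin_pos hP
  have hL := hl.trans_le (lamMin_le_lamMax hP.1)
  have hV : ∀ t, T0 ≤ t → HasDerivAt (fun s => d s ⬝ᵥ P.mulVec (d s)) _ t :=
    fun t ht => hasDerivAt_quad P d _ t (hode t ht)
  have main : ∀ t, T0 ≤ t → ε ≤ euclNorm (d t) →
      deriv (fun s => d s ⬝ᵥ P.mulVec (d s)) t ≤ -γstar * (d t ⬝ᵥ P.mulVec (d t)) := by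
    intro t ht hn
    rw [(hV t ht).deriv]
    refine scalar_bound (lamMin hQ0.1) (lamMax hP.1) (lamMin hP.1) (opNorm (A1ᵀ * P + P * A1))
      (opNorm P) lp δ ε (d t ⬝ᵥ d t) _ (euclNorm (d t)) _ γstar _ _ _ (deriv μ (d t 0)) (w t)
      (lamMin_pos hQ0) hL hl (norm_nonneg _) (norm_nonneg _) hlp hδ hε (euclNorm_sq _) hn hγdef
      (lamMin_mul_le hQ0.1 (d t)) (le_lamMax_mul hP.1 _) (lamMin_mul_le hP.1 _) ?_ ?_
      (abs_deriv_mu_le lp m hlp hm μ hμ _) (hw t ht) (quad_identity A0 A1 P hs (d t) _ _ _)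
    · rw [← euclNorm_sq, sq]
      exact abs_bilin_le _ _ _
    · have h := abs_bilin_le P (d t) ![0, 1]
      have h1 : euclNorm (![0, 1] : Fin 2 → ℝ) = 1 := by simp [euclNorm]
      rwa [h1, mul_one] at h
  refine ⟨main, ?_⟩
  by_contra! hcon
  set V : ℝ → ℝ := fun s => d s ⬝ᵥ P.mulVec (d s) with hVdef
  set c := γstar * (lamMin hP.1 * ε ^ 2) with hc
  have hcpos : 0 < c := by positivity
  have hVlow : ∀ t, T0 ≤ t → lamMin hP.1 * ε ^ 2 ≤ V t := by
    intro t ht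
    refine le_trans ?_ (lamMin_mul_le hP.1 (d t))
    rw [← euclNorm_sq]
    have := hcon t ht
    gcongr
  have hVpos : ∀ t, T0 ≤ t → 0 < V t := fun t ht => lt_of_lt_of_le (by positivity) (hVlow t ht)
  have hT : T0 ≤ T0 + V T0 / c := by
    have := hVpos T0 le_rfl
    have : 0 < V T0 / c := by positivity
    linarith
  have hmv := (convex_Ici T0).image_sub_le_mul_sub_of_deriv_le (f := V) (C := -c)
    (fun t ht => (hV t ht).continuousAt.continuousWithinAt)
    (fun t ht => (hV t (interior_subset ht)).differentiableAt.differentiableWithinAt)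
    (fun t ht => by
      have ht' : T0 ≤ t := interior_subset ht
      have h1 := main t ht' (hcon t ht').le
      have h2 := mul_le_mul_of_nonneg_left (hVlow t ht') hγpos.le
      linarith)
    T0 Set.self_mem_Ici _ hT hT
  have h3 : -c * (T0 + V T0 / c - T0) = - V T0 := by field_simp; ring
  have := hVpos _ hT
  linarith
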